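/- arXiv:math/0409046 — 2 statements merged into one kernel-verified Lean document; each statement's English description precedes it below -/
import Mathlib

section
/- Let Γ = (V, E) be a Cayley tree of order 2, with fixed root x₀ and balls V_n. For every integer m ≥ 0, the finite-volume Gibbs measures with all-plus boundary condition are small deviations of the ground state φ₊ ≡ 1 in the following uniform sense: lim_{β→∞} sup_{n ≥ 1} sup_{x ∈ V} μ_{n,β}^+ ({σ ∈ Ω_n^+ : σ(y) = −1 for some y ∈ V with d(x, y) ≤ m}) = 0. -/
/-- A Cayley tree of order 2: a connected acyclic simple graph every vertex of which has
degree 3. -/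
def IsCayleyTree2 {V : Type*} (Γ : SimpleGraph V) : Prop :=
  Γ.Connected ∧ Γ.IsAcyclic ∧ ∀ v : V, (Γ.neighborSet v).ncard = 3

/-- The outer boundary `∂A` of a set of vertices `A`. -/
def outerBoundary {V : Type*} (Γ : SimpleGraph V) (A : Set V) : Set V :=
  {x | x ∉ A ∧ ∃ y ∈ A, Γ.Adj x y}

/-- `C` is a connected component of the subgraph induced on `S`. -/
def IsCompOf {V : Type*} (Γ : SimpleGraph V) (S C : Set V) : Prop :=
  C ⊆ S ∧ C.Nonempty ∧ (Γ.induce C).Connected ∧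
    ∀ x ∈ S, ∀ y ∈ C, Γ.Adj x y → x ∈ C

/-- The ball `V_n = {x : d(x₀, x) ≤ n}` around the root `x₀`. -/
def ballSet {V : Type*} (Γ : SimpleGraph V) (x₀ : V) (n : ℕ) : Set V :=
  {x | Γ.dist x₀ x ≤ n}

/-- The set of edges of `Γ` having at least one endpoint in `A`. -/
def meetingEdges {V : Type*} (Γ : SimpleGraph V) (A : Set V) : Set (Sym2 V) :=
  {e | e ∈ Γ.edgeSet ∧ ∃ x ∈ A, x ∈ e}

/-- The ferromagnetic Ising Hamiltonian (`J₁ = −1`, `J₂ = 0`) in volume `V_n`: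
`H_n(σ) = −∑ σ(x)σ(y)`, the sum over all edges meeting `V_n`. -/
noncomputable def isingH {V : Type*} (Γ : SimpleGraph V) (x₀ : V) (n : ℕ) (σ : V → ℤ) : ℤ :=
  -∑ᶠ e ∈ meetingEdges Γ (ballSet Γ x₀ n),
      Sym2.lift ⟨fun x y => σ x * σ y, fun x y => mul_comm (σ x) (σ y)⟩ e

/-- `Ω_n^ε`: spin configurations equal to `ε` outside `V_n`. -/
def OmegaBC {V : Type*} (Γ : SimpleGraph V) (x₀ : V) (n : ℕ) (ε : ℤ) : Set (V → ℤ) :=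
  {σ | (∀ x, σ x = 1 ∨ σ x = -1) ∧ ∀ x ∉ ballSet Γ x₀ n, σ x = ε}

/-- The finite-volume Gibbs measure `μ_{n,β}^ε` of the event `A`. -/
noncomputable def gibbs {V : Type*} (Γ : SimpleGraph V) (x₀ : V) (n : ℕ) (β : ℝ) (ε : ℤ)
    (A : Set (V → ℤ)) : ℝ :=
  (∑ᶠ σ ∈ A ∩ OmegaBC Γ x₀ n ε, Real.exp (-β * (isingH Γ x₀ n σ : ℝ))) /
    ∑ᶠ σ ∈ OmegaBC Γ x₀ n ε, Real.exp (-β * (isingH Γ x₀ n σ : ℝ))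

open Finset in
/-- The number of edges of `Γ` with exactly one endpoint in `M`. -/
def edgeBoundaryCard {V : Type*} [DecidableEq V] (Γ : SimpleGraph V) [Γ.LocallyFinite]
    (M : Finset V) : ℕ :=
  ∑ v ∈ M, #(Γ.neighborFinset v \ M)

open Classical in
/-- The set of vertices of `M` reachable from `y` by a walk whose later vertices lie in `M`. -/
noncomputable def cluster {V : Type*} (Γ : SimpleGraph V) (y : V) (M : Finset V) : Finset V :=
  M.filter (Relation.ReflTransGen (fun u v => Γ.Adj u v ∧ v ∈ M) y)

section Cluster

variable {V : Type*} (Γ : SimpleGraph V) {y : V} {M M' : Finset V}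

lemma mem_cluster {z : V} : z ∈ cluster Γ y M ↔
    z ∈ M ∧ Relation.ReflTransGen (fun u v => Γ.Adj u v ∧ v ∈ M) y z := by
  classical
  simp [cluster]

lemma cluster_subset : cluster Γ y M ⊆ M := fun _ hz => ((mem_cluster Γ).mp hz).1

lemma mem_cluster_self (hy : y ∈ M) : y ∈ cluster Γ y M :=
  (mem_cluster Γ).mpr ⟨hy, .refl⟩

variable {Γ}

lemma mem_cluster_of_adj {u v : V} (hu : u ∈ cluster Γ y M) (huv : Γ.Adj u v) (hv : v ∈ M) :
    v ∈ cluster Γ y M := by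
  rw [mem_cluster] at hu ⊢
  exact ⟨hv, hu.2.tail ⟨huv, hv⟩⟩

lemma cluster_subset_of_closed {S : Finset V} (hy : y ∈ S)
    (hS : ∀ u ∈ S, ∀ v ∈ M, Γ.Adj u v → v ∈ S) : cluster Γ y M ⊆ S := by
  intro z hz
  have hz' := ((mem_cluster Γ).mp hz).2
  clear hz
  induction hz' with
  | refl => exact hy
  | tail _ h ih => exact hS _ ih _ h.2 h.1

lemma cluster_eq_of_isolated (hy : y ∈ M) (hsub : cluster Γ y M ⊆ M')
    (hbd : ∀ u ∈ cluster Γ y M, ∀ v ∈ M', Γ.Adj u v → v ∈ cluster Γ y M) :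
    cluster Γ y M' = cluster Γ y M := by
  apply Finset.Subset.antisymm
  · exact cluster_subset_of_closed (mem_cluster_self Γ hy) hbd
  · have hy' : y ∈ M' := hsub (mem_cluster_self Γ hy)
    intro z hz
    have hz' := ((mem_cluster Γ).mp hz).2
    clear hz
    have key : z ∈ cluster Γ y M ∧ z ∈ cluster Γ y M' := by
      induction hz' with
      | refl => exact ⟨mem_cluster_self Γ hy, mem_cluster_self Γ hy'⟩
      | tail _ h ih =>
        have h1 := mem_cluster_of_adj ih.1 h.1 h.2
        exact ⟨h1, mem_cluster_of_adj ih.2 h.1 (hsub h1)⟩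
    exact key.2

end Cluster

section Isoperimetry

open Finset

variable {V : Type*} {Γ : SimpleGraph V}

lemma SimpleGraph.IsTree.parent_unique (hΓ : Γ.IsTree) (x₀ : V) {u u' v : V}
    (hu : Γ.Adj u v) (hu' : Γ.Adj u' v) (h : Γ.dist x₀ u < Γ.dist x₀ v)
    (h' : Γ.dist x₀ u' < Γ.dist x₀ v) : u = u' := by
  obtain ⟨p, hp⟩ := hΓ.connected.exists_walk_length_eq_dist x₀ u
  obtain ⟨p', hp'⟩ := hΓ.connected.exists_walk_length_eq_dist x₀ u'
  have e := hΓ.dist_eq_dist_add_one_of_adj x₀ hu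
  have e' := hΓ.dist_eq_dist_add_one_of_adj x₀ hu'
  have q : (p.concat hu).IsPath :=
    SimpleGraph.Walk.isPath_of_length_eq_dist _ (by rw [SimpleGraph.Walk.length_concat]; lia)
  have q' : (p'.concat hu').IsPath :=
    SimpleGraph.Walk.isPath_of_length_eq_dist _ (by rw [SimpleGraph.Walk.length_concat]; lia)
  have := (hΓ.existsUnique_path x₀ v).unique q q'
  simpa using congrArg SimpleGraph.Walk.penultimate this

variable [DecidableEq V] [Γ.LocallyFinite]

lemma card_le_edgeBoundaryCard (hΓ : Γ.IsTree) (hdeg : ∀ v, #(Γ.neighborFinset v) = 3)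
    (C : Finset V) : #C ≤ edgeBoundaryCard Γ C := by
  classical
  obtain ⟨x₀⟩ := hΓ.connected.nonempty
  let r : V → V → Prop := fun v w => Γ.Adj v w ∧ Γ.dist x₀ v < Γ.dist x₀ w
  have children_card (v : V) : 2 ≤ #((Γ.neighborFinset v).filter (r v)) := by
    have h1 : #((Γ.neighborFinset v).filter (fun w => ¬ r v w)) ≤ 1 := by
      refine card_le_one.mpr fun a ha b hb => ?_
      simp only [mem_filter, SimpleGraph.mem_neighborFinset, r] at ha hb
      have hna := hΓ.dist_ne_of_adj x₀ ha.1
      have hnb := hΓ.dist_ne_of_adj x₀ hb.1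
      exact hΓ.parent_unique x₀ ha.1.symm hb.1.symm
        (lt_of_le_of_ne (not_lt.mp fun h => ha.2 ⟨ha.1, h⟩) hna.symm)
        (lt_of_le_of_ne (not_lt.mp fun h => hb.2 ⟨hb.1, h⟩) hnb.symm)
    have := card_filter_add_card_filter_not (s := Γ.neighborFinset v) (r v)
    have := hdeg v
    omega
  have split (v : V) : 2 ≤ #(C.bipartiteAbove r v) + #(Γ.neighborFinset v \ C) := by
    refine (children_card v).trans ((card_le_card ?_).trans (card_union_le _ _))
    intro w hw
    simp only [mem_filter, mem_union, mem_sdiff, bipartiteAbove] at hw ⊢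
    tauto
  have parents (w : V) : #(C.bipartiteBelow r w) ≤ 1 := by
    refine card_le_one.mpr fun a ha b hb => ?_
    simp only [mem_filter, bipartiteBelow, r] at ha hb
    exact hΓ.parent_unique x₀ ha.2.1 hb.2.1 ha.2.2 hb.2.2
  have h1 : ∑ v ∈ C, 2 ≤ ∑ v ∈ C, (#(C.bipartiteAbove r v) + #(Γ.neighborFinset v \ C)) :=
    sum_le_sum fun v _ => split v
  have h2 : ∑ w ∈ C, #(C.bipartiteBelow r w) ≤ ∑ w ∈ C, 1 := sum_le_sum fun w _ => parents w
  rw [sum_add_distrib, sum_card_bipartiteAbove_eq_sum_card_bipartiteBelow] at h1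
  simp only [sum_const, smul_eq_mul] at h1 h2
  unfold edgeBoundaryCard
  omega

lemma edgeBoundaryCard_eq_cluster_add (y : V) (M : Finset V) :
    edgeBoundaryCard Γ M =
      edgeBoundaryCard Γ (cluster Γ y M) + edgeBoundaryCard Γ (M \ cluster Γ y M) := by
  have hsub := cluster_subset Γ (y := y) (M := M)
  unfold edgeBoundaryCard
  rw [← sum_sdiff hsub, add_comm]
  congr 1
  · refine sum_congr rfl fun v hv => congrArg card ?_
    ext w
    simp only [mem_sdiff, SimpleGraph.mem_neighborFinset]
    exact and_congr_right fun hvw =>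
      not_congr ⟨fun hw => mem_cluster_of_adj hv hvw hw, fun hw => hsub hw⟩
  · refine sum_congr rfl fun v hv => congrArg card ?_
    rw [mem_sdiff] at hv
    ext w
    simp only [mem_sdiff, SimpleGraph.mem_neighborFinset]
    refine and_congr_right fun hvw => not_congr ⟨fun hw => ⟨hw, fun hc => ?_⟩, fun hw => hw.1⟩
    exact hv.2 (mem_cluster_of_adj hc hvw.symm hv.1)

/-- The sum over clusters `C` of `16 ^ (-#C)` is at most one: this bounds the probability that
`C` is the cluster of `y` in a uniformly random set of vertices. -/
lemma sum_clusters_le_one (hdeg : ∀ v, #(Γ.neighborFinset v) = 3) (B : Finset V) (y : V) :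
    ∑ C ∈ ((B.powerset.filter (y ∈ ·)).image (cluster Γ y)), ((16 : ℝ)⁻¹) ^ #C ≤ 1 := by
  classical
  let D : Finset V → Finset V := fun C => C.biUnion fun v => insert v (Γ.neighborFinset v)
  have hDcard (C : Finset V) : #(D C) ≤ 4 * #C := by
    refine card_biUnion_le.trans ?_
    rw [mul_comm, ← smul_eq_mul, ← sum_const]
    refine sum_le_sum fun v _ => (card_insert_le _ _).trans ?_
    rw [hdeg]
  set K := (B.powerset.filter (y ∈ ·)).image (cluster Γ y)
  let U := D B
  have hDU {C : Finset V} (hC : C ∈ K) : D C ⊆ U := by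
    obtain ⟨M, hM, rfl⟩ := mem_image.mp hC
    exact biUnion_subset_biUnion_of_subset_left _
      ((cluster_subset Γ).trans (mem_powerset.mp (mem_filter.mp hM).1))
  have hCD (C : Finset V) : C ⊆ D C := fun v hv =>
    mem_biUnion.mpr ⟨v, hv, mem_insert_self _ _⟩
  have hfib {C : Finset V} (hC : C ∈ K) :
      2 ^ (#U - #(D C)) ≤ #(U.powerset.filter fun M => cluster Γ y M = C) := by
    rw [← card_sdiff_of_subset (hDU hC), ← card_powerset]
    refine card_le_card_of_injOn (fun M => C ∪ M) ?_ ?_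
    · intro M hM
      have hM : M ⊆ U \ D C := mem_powerset.mp hM
      simp only [coe_filter, mem_powerset, Set.mem_ofPred_eq]
      refine ⟨union_subset ((hCD C).trans (hDU hC)) (hM.trans sdiff_subset), ?_⟩
      obtain ⟨N, hN, rfl⟩ := mem_image.mp hC
      refine cluster_eq_of_isolated (mem_filter.mp hN).2 subset_union_left ?_
      intro u hu v hv huv
      rcases mem_union.mp hv with hv | hv
      · exact hv
      · refine absurd ?_ (mem_sdiff.mp (hM hv)).2
        exact mem_biUnion.mpr ⟨u, hu, mem_insert_of_mem (by simpa using huv)⟩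
    · intro M hM M' hM' h
      have disj {N : Finset V} (hN : N ∈ (↑((U \ D C).powerset) : Set (Finset V))) :
          Disjoint C N := by
        have hN : N ⊆ U \ D C := mem_powerset.mp hN
        exact disjoint_left.mpr fun v hv hv' => (mem_sdiff.mp (hN hv')).2 (hCD C hv)
      rw [← union_sdiff_cancel_left (disj hM), ← union_sdiff_cancel_left (disj hM')]
      exact congrArg (· \ C) h
  have htot : ∑ C ∈ K, 2 ^ (#U - #(D C)) ≤ 2 ^ #U := by
    refine (sum_le_sum fun C hC => hfib hC).trans ?_
    rw [← card_powerset]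
    rw [← card_biUnion]
    · exact card_le_card (biUnion_subset.mpr fun _ _ => filter_subset _ _)
    · exact fun C _ C' _ h => disjoint_filter.mpr fun M _ hM hM' => h (hM ▸ hM')
  have hpos : (0 : ℝ) < 2 ^ #U := by positivity
  refine le_of_mul_le_mul_left ?_ hpos
  rw [mul_one, mul_sum]
  calc ∑ C ∈ K, (2 : ℝ) ^ #U * (16 : ℝ)⁻¹ ^ #C
      ≤ ∑ C ∈ K, (2 : ℝ) ^ (#U - #(D C)) := by
        refine sum_le_sum fun C hC => ?_
        have h16 : (16 : ℝ)⁻¹ ^ #C = (2 ^ (4 * #C))⁻¹ := by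
          rw [pow_mul, inv_pow]; norm_num
        rw [h16, ← div_eq_mul_inv, div_le_iff₀ (by positivity), ← pow_add]
        refine pow_le_pow_right₀ one_le_two ?_
        have := hDcard C
        omega
    _ ≤ 2 ^ #U := by exact_mod_cast htot

/-- The Peierls bound: with boundary weight `a`, the weight of the sets containing `y` is at
most `16 * a` times the total weight. -/
lemma peierls_bound (hΓ : Γ.IsTree) (hdeg : ∀ v, #(Γ.neighborFinset v) = 3) (B : Finset V)
    (y : V) {a : ℝ} (ha : 0 ≤ a) (ha' : 16 * a ≤ 1) :
    ∑ M ∈ B.powerset.filter (y ∈ ·), a ^ edgeBoundaryCard Γ M ≤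
      16 * a * ∑ M ∈ B.powerset, a ^ edgeBoundaryCard Γ M := by
  classical
  set Z := ∑ M ∈ B.powerset, a ^ edgeBoundaryCard Γ M
  have hZ : 0 ≤ Z := sum_nonneg fun _ _ => by positivity
  set K := (B.powerset.filter (y ∈ ·)).image (cluster Γ y)
  have hterm {C : Finset V} (hC : C ∈ K) :
      a ^ edgeBoundaryCard Γ C ≤ 16 * a * (16 : ℝ)⁻¹ ^ #C := by
    obtain ⟨M, hM, rfl⟩ := mem_image.mp hC
    have hne : #(cluster Γ y M) ≠ 0 :=
      card_ne_zero_of_mem (mem_cluster_self Γ (mem_filter.mp hM).2)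
    calc a ^ edgeBoundaryCard Γ (cluster Γ y M) ≤ a ^ #(cluster Γ y M) :=
          pow_le_pow_of_le_one ha (by linarith) (card_le_edgeBoundaryCard hΓ hdeg _)
      _ = (16 * a) ^ #(cluster Γ y M) * (16 : ℝ)⁻¹ ^ #(cluster Γ y M) := by
          rw [← mul_pow]; congr 1; ring
      _ ≤ _ := by
          gcongr
          exact pow_le_of_le_one (by positivity) ha' hne
  calc ∑ M ∈ B.powerset.filter (y ∈ ·), a ^ edgeBoundaryCard Γ M
      = ∑ C ∈ K, ∑ M ∈ (B.powerset.filter (y ∈ ·)).filter (fun M => cluster Γ y M = C),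
          a ^ edgeBoundaryCard Γ M :=
        (sum_fiberwise_of_maps_to (fun M hM => mem_image_of_mem _ hM) _).symm
    _ ≤ ∑ C ∈ K, a ^ edgeBoundaryCard Γ C * Z := by
        refine sum_le_sum fun C _ => ?_
        have hsplit : ∀ M ∈ (B.powerset.filter (y ∈ ·)).filter (fun M => cluster Γ y M = C),
            a ^ edgeBoundaryCard Γ M =
              a ^ edgeBoundaryCard Γ C * a ^ edgeBoundaryCard Γ (M \ C) := by
          intro M hM
          obtain rfl := (mem_filter.mp hM).2
          rw [← pow_add, ← edgeBoundaryCard_eq_cluster_add]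
        rw [sum_congr rfl hsplit, ← mul_sum]
        refine mul_le_mul_of_nonneg_left ?_ (by positivity)
        rw [← sum_image (f := fun N => a ^ edgeBoundaryCard Γ N) (g := fun M => M \ C)]
        · refine sum_le_sum_of_subset_of_nonneg ?_ fun _ _ _ => by positivity
          intro N hN
          obtain ⟨M, hM, rfl⟩ := mem_image.mp hN
          simp only [mem_filter, mem_powerset] at hM ⊢
          exact sdiff_subset.trans hM.1.1
        · intro M hM M' hM' h
          have e := (mem_filter.mp hM).2 ▸ cluster_subset Γ (y := y) (M := M)
          have e' := (mem_filter.mp hM').2 ▸ cluster_subset Γ (y := y) (M := M')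
          rw [← sdiff_union_of_subset e, ← sdiff_union_of_subset e']
          exact congrArg (· ∪ C) h
    _ ≤ ∑ C ∈ K, 16 * a * (16 : ℝ)⁻¹ ^ #C * Z := by
        gcongr with C hC
        exact hterm hC
    _ = 16 * a * (∑ C ∈ K, (16 : ℝ)⁻¹ ^ #C) * Z := by
        rw [mul_sum K, sum_mul K]
    _ ≤ 16 * a * 1 * Z := by
        gcongr
        exact sum_clusters_le_one hdeg B y
    _ = 16 * a * Z := by ring

lemma exists_ball_finset (hΓ : Γ.Connected) (hdeg : ∀ v, #(Γ.neighborFinset v) = 3) (x : V)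
    (n : ℕ) : ∃ B : Finset V, (∀ v, v ∈ B ↔ Γ.dist x v ≤ n) ∧ #B ≤ 4 ^ n := by
  suffices ∃ B : Finset V, (∀ v, Γ.dist x v ≤ n → v ∈ B) ∧ #B ≤ 4 ^ n by
    obtain ⟨B, hB, hcard⟩ := this
    refine ⟨B.filter fun v => Γ.dist x v ≤ n, fun v => ?_, (card_filter_le _ _).trans hcard⟩
    rw [mem_filter]
    exact ⟨fun h => h.2, fun h => ⟨hB v h, h⟩⟩
  induction n with
  | zero =>
    refine ⟨{x}, fun v hv => ?_, by simp⟩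
    simpa [hΓ.dist_eq_zero_iff, eq_comm (a := v)] using hv
  | succ n ih =>
    obtain ⟨B, hB, hcard⟩ := ih
    refine ⟨B.biUnion fun v => insert v (Γ.neighborFinset v), fun v hv => ?_, ?_⟩
    · rw [mem_biUnion]
      rcases Nat.lt_or_ge n (Γ.dist x v) with h | h
      · obtain ⟨p, hp⟩ := hΓ.exists_walk_length_eq_dist x v
        have hnil : ¬ p.Nil := fun hn => by
          have := SimpleGraph.Walk.length_eq_zero_iff.mpr hn
          omega
        have hadj := p.adj_penultimate hnil
        refine ⟨p.penultimate, hB _ ?_, mem_insert_of_mem (by simpa using hadj)⟩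
        have := SimpleGraph.dist_le p.dropLast
        have := p.length_dropLast_add_one hnil
        omega
      · exact ⟨v, hB v h, mem_insert_self _ _⟩
    · refine card_biUnion_le.trans ?_
      calc ∑ v ∈ B, #(insert v (Γ.neighborFinset v)) ≤ ∑ v ∈ B, 4 :=
            sum_le_sum fun v _ => (card_insert_le _ _).trans (by rw [hdeg])
        _ ≤ 4 ^ (n + 1) := by
            rw [sum_const, smul_eq_mul, pow_succ]
            exact Nat.mul_le_mul_right 4 hcard

end Isoperimetry

lemma Finset.sum_biUnion_le_of_nonneg {ι α : Type*} [DecidableEq α] {s : Finset ι}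
    {t : ι → Finset α} {f : α → ℝ} (hf : ∀ x, 0 ≤ f x) :
    ∑ x ∈ s.biUnion t, f x ≤ ∑ i ∈ s, ∑ x ∈ t i, f x := by
  classical
  induction s using Finset.induction_on with
  | empty => simp
  | insert i s hi ih =>
    rw [biUnion_insert, sum_insert hi]
    have h := sum_union_inter (s₁ := t i) (s₂ := s.biUnion t) (f := f)
    have h' : 0 ≤ ∑ x ∈ t i ∩ s.biUnion t, f x := sum_nonneg fun x _ => hf x
    linarith

section Gibbs

open Finset

variable {V : Type*} [DecidableEq V]

/-- The configuration equal to `-1` exactly on `M`. -/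
def spinOf (M : Finset V) : V → ℤ := fun v => if v ∈ M then -1 else 1

lemma spinOf_eq_neg_one_iff {M : Finset V} {v : V} : spinOf M v = -1 ↔ v ∈ M := by
  unfold spinOf
  split_ifs <;> simp_all

lemma spinOf_injective : Function.Injective (spinOf : Finset V → V → ℤ) := by
  intro M N h
  ext v
  rw [← spinOf_eq_neg_one_iff, ← spinOf_eq_neg_one_iff, h]

variable {Γ : SimpleGraph V} {x₀ : V} {n : ℕ} {B : Finset V}

lemma inter_omegaBC_eq_image (hB : ∀ v, v ∈ B ↔ Γ.dist x₀ v ≤ n) (A : Set (V → ℤ))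
    [DecidablePred fun M => spinOf M ∈ A] :
    A ∩ OmegaBC Γ x₀ n 1 =
      spinOf '' (↑(B.powerset.filter fun M => spinOf M ∈ A) : Set (Finset V)) := by
  ext σ
  simp only [Set.mem_inter_iff, Set.mem_image, coe_filter, mem_powerset, Set.mem_ofPred_eq]
  constructor
  · rintro ⟨hA, hσ, hbc⟩
    have heq : spinOf (B.filter fun v => σ v = -1) = σ := by
      funext v
      by_cases hv : v ∈ B
      · rcases hσ v with h | h <;> simp [spinOf, hv, h]
      · rw [hbc v (by simpa [ballSet, hB] using hv)]
        simp [spinOf, hv]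
    exact ⟨_, ⟨filter_subset _ _, heq.symm ▸ hA⟩, heq⟩
  · rintro ⟨M, ⟨hM, hA⟩, rfl⟩
    refine ⟨hA, fun v => ?_, fun v hv => ?_⟩
    · unfold spinOf
      split_ifs <;> simp
    · have : v ∉ M := fun h => hv ((hB v).mp (hM h))
      simp [spinOf, this]

variable [Γ.LocallyFinite]

lemma isingH_spinOf (hB : ∀ v, v ∈ B ↔ Γ.dist x₀ v ≤ n) :
    ∃ c : ℤ, ∀ M ⊆ B, isingH Γ x₀ n (spinOf M) = c + 2 * edgeBoundaryCard Γ M := by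
  classical
  have hfin : (meetingEdges Γ (ballSet Γ x₀ n)).Finite := by
    refine (B.biUnion fun v => (Γ.neighborFinset v).image (s(v, ·))).finite_toSet.subset ?_
    rintro e ⟨he, x, hx, hxe⟩
    obtain ⟨y, rfl⟩ := Sym2.mem_iff_exists.mp hxe
    simp only [coe_biUnion, Set.mem_iUnion, mem_coe, mem_image]
    exact ⟨x, (hB x).mpr hx, y, by simpa using he, rfl⟩
  refine ⟨-#hfin.toFinset, fun M hM => ?_⟩
  unfold isingH
  rw [finsum_mem_eq_finite_toFinset_sum _ hfin]
  set f : Sym2 V → ℤ := Sym2.lift ⟨fun x y => spinOf M x * spinOf M y, fun x y => mul_comm _ _⟩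
  have hf (e : Sym2 V) : f e = 1 - 2 * if f e = -1 then 1 else 0 := by
    induction e with
    | _ x y =>
      simp only [f, Sym2.lift_mk, spinOf]
      split_ifs <;> simp_all
  have hcard : #(hfin.toFinset.filter fun e => f e = -1) = edgeBoundaryCard Γ M := by
    unfold edgeBoundaryCard
    rw [← card_sigma]
    symm
    refine card_bij (fun p _ => s(p.1, p.2)) ?_ ?_ ?_
    · rintro ⟨v, w⟩ h
      simp only [mem_sigma, mem_sdiff, SimpleGraph.mem_neighborFinset] at h
      simp only [mem_filter, Set.Finite.mem_toFinset]
      refine ⟨⟨h.2.1, v, (hB v).mp (hM h.1), Sym2.mem_mk_left _ _⟩, ?_⟩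
      simp [f, spinOf, h.1, h.2.2]
    · rintro ⟨v, w⟩ h ⟨v', w'⟩ h' e
      simp only [mem_sigma, mem_sdiff] at h h'
      rcases Sym2.eq_iff.mp e with ⟨h1, h2⟩ | ⟨h1, h2⟩
      · dsimp only at h1 h2
        subst h1 h2
        rfl
      · dsimp only at h1 h2
        subst h1 h2
        exact absurd h.1 h'.2.2
    · intro e he
      simp only [mem_filter, Set.Finite.mem_toFinset] at he
      obtain ⟨⟨hadj, -⟩, hfe⟩ := he
      induction e with
      | _ x y =>
        have hadj : Γ.Adj x y := hadj
        simp only [f, Sym2.lift_mk, spinOf] at hfe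
        by_cases hx : x ∈ M <;> by_cases hy : y ∈ M
        · simp [hx, hy] at hfe
        · exact ⟨⟨x, y⟩, by simp [hx, hy, hadj], rfl⟩
        · exact ⟨⟨y, x⟩, by simp [hx, hy, hadj.symm], Sym2.eq_swap⟩
        · simp [hx, hy] at hfe
  rw [sum_congr rfl fun e _ => hf e, sum_sub_distrib, ← mul_sum, sum_boole, hcard]
  simp
  ring

lemma gibbs_eq (hB : ∀ v, v ∈ B ↔ Γ.dist x₀ v ≤ n) (β : ℝ) (A : Set (V → ℤ))
    [DecidablePred fun M => spinOf M ∈ A] :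
    gibbs Γ x₀ n β 1 A =
      (∑ M ∈ B.powerset.filter fun M => spinOf M ∈ A,
        Real.exp (-2 * β) ^ edgeBoundaryCard Γ M) /
      ∑ M ∈ B.powerset, Real.exp (-2 * β) ^ edgeBoundaryCard Γ M := by
  classical
  obtain ⟨c, hc⟩ := isingH_spinOf (Γ := Γ) hB
  have hexp : ∀ M ∈ B.powerset, Real.exp (-β * (isingH Γ x₀ n (spinOf M) : ℝ)) =
      Real.exp (-β * c) * Real.exp (-2 * β) ^ edgeBoundaryCard Γ M := by
    intro M hM
    rw [hc M (mem_powerset.mp hM), ← Real.exp_nat_mul, ← Real.exp_add]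
    push_cast
    ring_nf
  have hsum (A : Set (V → ℤ)) [DecidablePred fun M => spinOf M ∈ A] :
      ∑ᶠ σ ∈ A ∩ OmegaBC Γ x₀ n 1, Real.exp (-β * (isingH Γ x₀ n σ : ℝ)) =
        Real.exp (-β * c) * ∑ M ∈ B.powerset.filter fun M => spinOf M ∈ A,
          Real.exp (-2 * β) ^ edgeBoundaryCard Γ M := by
    rw [inter_omegaBC_eq_image hB, finsum_mem_image spinOf_injective.injOn,
      finsum_mem_coe_finset, mul_sum]
    exact sum_congr rfl fun M hM => hexp M (mem_filter.mp hM).1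
  have htot := hsum Set.univ
  simp only [Set.univ_inter, Set.mem_univ, filter_true] at htot
  unfold gibbs
  rw [hsum, htot, mul_div_mul_left _ _ (Real.exp_pos _).ne']

lemma gibbs_nonneg (hB : ∀ v, v ∈ B ↔ Γ.dist x₀ v ≤ n) (β : ℝ) (A : Set (V → ℤ)) :
    0 ≤ gibbs Γ x₀ n β 1 A := by
  classical
  rw [gibbs_eq hB]
  positivity

lemma gibbs_exists_minus_le (hΓ : Γ.IsTree) (hdeg : ∀ v, #(Γ.neighborFinset v) = 3) (x₀ : V)
    (n m : ℕ) (x : V) {β : ℝ} (hβ : 16 * Real.exp (-2 * β) ≤ 1) :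
    gibbs Γ x₀ n β 1 {σ | ∃ y : V, Γ.dist x y ≤ m ∧ σ y = -1} ≤
      4 ^ m * (16 * Real.exp (-2 * β)) := by
  classical
  obtain ⟨B, hB, -⟩ := exists_ball_finset hΓ.connected hdeg x₀ n
  obtain ⟨S, hS, hcard⟩ := exists_ball_finset hΓ.connected hdeg x m
  rw [gibbs_eq hB]
  set a := Real.exp (-2 * β)
  have ha : 0 < a := Real.exp_pos _
  set Z := ∑ M ∈ B.powerset, a ^ edgeBoundaryCard Γ M
  have hZ : 0 < Z := sum_pos (fun _ _ => by positivity) ⟨∅, by simp⟩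
  rw [div_le_iff₀ hZ]
  calc _ ≤ ∑ M ∈ S.biUnion fun y => B.powerset.filter (y ∈ ·), a ^ edgeBoundaryCard Γ M := by
        refine sum_le_sum_of_subset_of_nonneg ?_ fun _ _ _ => by positivity
        intro M hM
        simp only [mem_filter, Set.mem_ofPred_eq, spinOf_eq_neg_one_iff, mem_biUnion] at hM ⊢
        obtain ⟨hMB, y, hy, hyM⟩ := hM
        exact ⟨y, (hS y).mpr hy, hMB, hyM⟩
    _ ≤ ∑ y ∈ S, ∑ M ∈ B.powerset.filter (y ∈ ·), a ^ edgeBoundaryCard Γ M :=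
        sum_biUnion_le_of_nonneg fun _ => by positivity
    _ ≤ ∑ y ∈ S, 16 * a * Z := sum_le_sum fun y _ => peierls_bound hΓ hdeg B y ha.le hβ
    _ = #S * (16 * a * Z) := by rw [sum_const, nsmul_eq_mul]
    _ ≤ 4 ^ m * (16 * a * Z) := by
        gcongr
        exact_mod_cast hcard
    _ = 4 ^ m * (16 * a) * Z := by ring

end Gibbs

/-- Small deviations: for every radius `m`, the `μ_{n,β}^+`-probability of seeing a minus
spin anywhere in the radius-`m` ball around `x` tends to `0` as `β → ∞`, uniformly in the
volume `n ≥ 1` and in the centre `x ∈ V`. -/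
theorem small_deviation_of_plus {V : Type*} (Γ : SimpleGraph V) (hΓ : IsCayleyTree2 Γ)
    (x₀ : V) (m : ℕ) :
    Filter.Tendsto (fun β : ℝ =>
        ⨆ p : {n : ℕ // 1 ≤ n} × V,
          gibbs Γ x₀ p.1 β 1 {σ | ∃ y : V, Γ.dist p.2 y ≤ m ∧ σ y = -1})
      Filter.atTop (nhds 0) := by
  classical
  obtain ⟨hconn, hacyc, hncard⟩ := hΓ
  have htree : Γ.IsTree := ⟨hconn, hacyc⟩
  let _ : Γ.LocallyFinite := fun v =>
    (Set.finite_of_ncard_ne_zero (by rw [hncard v]; norm_num)).fintype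
  have hdeg (v : V) : (Γ.neighborFinset v).card = 3 := by
    rw [← hncard v, SimpleGraph.neighborFinset, Set.ncard_eq_toFinset_card']
  have hlim : Filter.Tendsto (fun β : ℝ => 16 * Real.exp (-2 * β)) Filter.atTop (nhds 0) := by
    have h : Filter.Tendsto (fun β : ℝ => -2 * β) Filter.atTop Filter.atBot :=
      Filter.tendsto_id.const_mul_atTop_of_neg (by norm_num)
    simpa using (Real.tendsto_exp_atBot.comp h).const_mul 16
  have hbound : Filter.Tendsto (fun β : ℝ => 4 ^ m * (16 * Real.exp (-2 * β))) Filter.atTop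
      (nhds 0) := by
    simpa using hlim.const_mul (4 ^ m)
  refine squeeze_zero' (Filter.Eventually.of_forall fun β => Real.iSup_nonneg fun p => ?_) ?_ hbound
  · obtain ⟨B, hB, -⟩ := exists_ball_finset hconn hdeg x₀ p.1
    exact gibbs_nonneg hB β _
  · filter_upwards [hlim.eventually_le_const one_pos] with β hβ
    exact Real.iSup_le (fun p => gibbs_exists_minus_le htree hdeg x₀ p.1 m p.2 hβ) (by positivity)
end

section
/- Let Γ = (V, E) be a Cayley tree of order 2, with fixed root x₀ and balls V_n, and let λ₁₁, λ₂₂, λ₁₂ = λ₂₁ be real numbers. For every n ≥ 1 and every configuration ω ∈ Ω_n^{(1)} (i.e. ω : V → {v₁, v₂} with ω ≡ v₁ off V_n), the energy H_n^{(1)}(ω) = ∑_{edges {x,y}, {x,y} ∩ V_n ≠ ∅} λ(ω(x), ω(y)) satisfies H_n^{(1)}(ω) = (λ₂₁ + λ₂₂ − 2λ₁₁)·B(ω) + 3m(ω)·(λ₁₁ − λ₂₂) + λ₁₁·(|V_{n+1}| − 1), where m(ω) is the number of connected components of ω^{−1}(v₂) and B(ω) = ∑_C |∂C| is the total contour length,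 the sum running over the connected components C of ω^{−1}(v₂). -/
/-- `Ω_n^{(1)}`: configurations with values in `{v₁, v₂}` equal to `v₁` outside `V_n`. -/
def OmegaGen {V W : Type*} (Γ : SimpleGraph V) (x₀ : V) (n : ℕ) (v₁ v₂ : W) :
    Set (V → W) :=
  {ω | (∀ x, ω x = v₁ ∨ ω x = v₂) ∧ ∀ x ∉ ballSet Γ x₀ n, ω x = v₁}

/-- The energy `H_n^{(1)}(ω) = ∑ λ(ω(x), ω(y))`, the sum over all edges meeting `V_n`, of
the two-spin model with symmetric interaction `lam`. -/
noncomputable def genH {V W : Type*} (Γ : SimpleGraph V) (x₀ : V) (n : ℕ)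
    (lam : W → W → ℝ) (hsymm : ∀ a b, lam a b = lam b a) (ω : V → W) : ℝ :=
  ∑ᶠ e ∈ meetingEdges Γ (ballSet Γ x₀ n),
    Sym2.lift ⟨fun x y => lam (ω x) (ω y), fun x y => hsymm (ω x) (ω y)⟩ e

/-- The edges of `Γ` with both endpoints in `A`. -/
def innerEdges {V : Type*} (Γ : SimpleGraph V) (A : Set V) : Set (Sym2 V) :=
  {e | e ∈ Γ.edgeSet ∧ ∀ x ∈ e, x ∈ A}

/-- The edges of `Γ` with exactly one endpoint in `A`. -/
def cutEdges {V : Type*} (Γ : SimpleGraph V) (A : Set V) : Set (Sym2 V) :=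
  {e | e ∈ Γ.edgeSet ∧ (∃ x ∈ e, x ∈ A) ∧ ∃ x ∈ e, x ∉ A}

section ContourCounting

variable {V : Type*} {Γ : SimpleGraph V}

lemma meetingEdges_eq_union (A : Set V) :
    meetingEdges Γ A = innerEdges Γ A ∪ cutEdges Γ A := by
  ext e
  induction e with | _ x y =>
  simp only [meetingEdges, innerEdges, cutEdges, Set.mem_union, Set.mem_ofPred_eq, Sym2.mem_iff]
  grind

lemma disjoint_innerEdges_cutEdges (A : Set V) :
    Disjoint (innerEdges Γ A) (cutEdges Γ A) := by
  rw [Set.disjoint_left]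
  rintro e he ⟨-, -, x, hx, hxA⟩
  exact hxA (he.2 x hx)

/-- In an acyclic graph a vertex outside a connected set has at most one neighbour in it. -/
lemma eq_of_adj_of_connected_induce (hac : Γ.IsAcyclic) {A : Set V}
    (hA : (Γ.induce A).Connected) {x y z : V} (hx : x ∉ A) (hy : y ∈ A) (hz : z ∈ A)
    (hxy : Γ.Adj x y) (hxz : Γ.Adj x z) : y = z := by
  by_contra hne
  obtain ⟨p, hp⟩ := (hA.preconnected ⟨y, hy⟩ ⟨z, hz⟩).exists_isPath
  let f := (SimpleGraph.Embedding.induce (G := Γ) A).toHom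
  have hp' : (p.map f).IsPath := hp.map Subtype.val_injective
  let q : Γ.Walk y z := .cons hxy.symm (.cons hxz .nil)
  have hq : q.IsPath := by
    simp [q, hxz.ne, hxy.ne.symm, hne]
  have h : p.map f = q :=
    congrArg Subtype.val ((hac.subsingleton_path y z).elim ⟨p.map f, hp'⟩ ⟨q, hq⟩)
  have hxq : x ∈ (p.map f).support :=
    (congrArg (fun w : Γ.Walk y z => x ∈ w.support) h).mpr (by simp [q])
  rw [SimpleGraph.Walk.support_map, List.mem_map] at hxq
  obtain ⟨w, -, rfl⟩ := hxq
  exact hx w.2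

lemma ncard_cutEdges (hac : Γ.IsAcyclic) {A : Set V} (hA : (Γ.induce A).Connected) :
    (cutEdges Γ A).ncard = (outerBoundary Γ A).ncard := by
  symm
  choose f hf hadj using fun x (hx : x ∈ outerBoundary Γ A) => hx.2
  refine Set.ncard_congr (fun x hx => s(x, f x hx)) ?_ ?_ ?_
  · intro x hx
    exact ⟨hadj x hx, ⟨f x hx, by simp, hf x hx⟩, ⟨x, by simp, hx.1⟩⟩
  · intro x y hx hy h
    have := hf x hx
    have := hf y hy
    have := hx.1
    have := hy.1
    grind
  · intro e
    induction e with | _ x y =>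
    rintro ⟨he, hin, hout⟩
    simp only [Sym2.mem_iff] at hin hout
    have key : ∀ a b, Γ.Adj a b → a ∈ A → b ∉ A →
        ∃ c, ∃ hc : c ∈ outerBoundary Γ A, s(c, f c hc) = s(a, b) := by
      intro a b hab ha hb
      have hb' : b ∈ outerBoundary Γ A := ⟨hb, a, ha, hab.symm⟩
      refine ⟨b, hb', ?_⟩
      rw [eq_of_adj_of_connected_induce hac hA hb (hf b hb') ha (hadj b hb') hab.symm,
        Sym2.eq_swap]
    by_cases hx : x ∈ A
    · exact key x y he hx (by grind)
    · rw [Sym2.eq_swap]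
      exact key y x (SimpleGraph.Adj.symm he) (by grind) hx

lemma image_edgeSet_induce (A : Set V) :
    Sym2.map Subtype.val '' (Γ.induce A).edgeSet = innerEdges Γ A := by
  ext e
  constructor
  · rintro ⟨e, he, rfl⟩
    induction e with | _ x y =>
    exact ⟨he, by simp⟩
  · induction e with | _ x y =>
    rintro ⟨he, h⟩
    simp only [Sym2.mem_iff, forall_eq_or_imp, forall_eq] at h
    exact ⟨s(⟨x, h.1⟩, ⟨y, h.2⟩), he, rfl⟩

lemma ncard_innerEdges_eq_ncard_edgeSet (A : Set V) :
    (innerEdges Γ A).ncard = (Γ.induce A).edgeSet.ncard := by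
  rw [← image_edgeSet_induce,
    Set.ncard_image_of_injective _ (Sym2.map.injective Subtype.val_injective)]

lemma ncard_innerEdges_add_one (hac : Γ.IsAcyclic) {A : Set V} (hfin : A.Finite)
    (hA : (Γ.induce A).Connected) : (innerEdges Γ A).ncard + 1 = A.ncard := by
  classical
  have := hfin.fintype
  have h := (SimpleGraph.IsTree.mk hA (hac.induce A)).card_edgeFinset
  rw [ncard_innerEdges_eq_ncard_edgeSet, ← SimpleGraph.coe_edgeFinset, Set.ncard_coe_finset, h,
    ← Nat.card_eq_fintype_card, Nat.card_coe_set_eq]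

lemma sum_ncard_neighborSet_inter {A : Set V} [Fintype A] :
    ∑ v : A, (Γ.neighborSet v ∩ A).ncard = 2 * (innerEdges Γ A).ncard := by
  classical
  rw [ncard_innerEdges_eq_ncard_edgeSet, ← SimpleGraph.coe_edgeFinset, Set.ncard_coe_finset,
    ← SimpleGraph.sum_degrees_eq_twice_card_edges]
  refine Finset.sum_congr rfl fun v _ => ?_
  rw [← SimpleGraph.card_neighborFinset_eq_degree, ← Set.ncard_coe_finset,
    SimpleGraph.coe_neighborFinset, ← Set.ncard_image_of_injective _ Subtype.val_injective]
  congr 1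
  ext w
  simp [and_comm]

lemma sum_ncard_neighborSet_diff (hac : Γ.IsAcyclic) (hfn : ∀ v, (Γ.neighborSet v).Finite)
    {A : Set V} [Fintype A] (hA : (Γ.induce A).Connected) :
    ∑ v : A, (Γ.neighborSet v \ A).ncard = (outerBoundary Γ A).ncard := by
  have h : outerBoundary Γ A = ⋃ v : A, (Γ.neighborSet v \ A) := by
    ext x
    simp only [outerBoundary, Set.mem_ofPred_eq, Set.mem_iUnion, Set.mem_sdiff,
      SimpleGraph.mem_neighborSet, Subtype.exists, exists_prop]
    constructor
    · rintro ⟨hx, y, hy, h⟩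
      exact ⟨y, hy, h.symm, hx⟩
    · rintro ⟨y, hy, h, hx⟩
      exact ⟨hx, y, hy, h.symm⟩
  rw [h, Set.ncard_iUnion_of_finite fun v : A => (hfn v).sdiff, finsum_eq_sum_of_fintype]
  · intro v w hvw
    refine Set.disjoint_left.2 fun x hx hx' => hvw (Subtype.ext ?_)
    exact eq_of_adj_of_connected_induce hac hA hx.2 v.2 w.2 hx.1.symm hx'.1.symm

/-- In a Cayley tree of order two the outer boundary of a finite connected set `A` has
`|A| + 2` elements. -/
lemma ncard_outerBoundary (hΓ : IsCayleyTree2 Γ) {A : Set V} (hfin : A.Finite)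
    (hA : (Γ.induce A).Connected) : (outerBoundary Γ A).ncard = A.ncard + 2 := by
  have := hfin.fintype
  have hfn : ∀ v, (Γ.neighborSet v).Finite := fun v =>
    Set.finite_of_ncard_ne_zero (by rw [hΓ.2.2 v]; decide)
  have h1 := sum_ncard_neighborSet_inter (Γ := Γ) (A := A)
  have h2 := sum_ncard_neighborSet_diff hΓ.2.1 hfn hA
  have h3 := ncard_innerEdges_add_one hΓ.2.1 hfin hA
  have h4 : ∑ v : A, ((Γ.neighborSet v ∩ A).ncard + (Γ.neighborSet v \ A).ncard)
      = 3 * A.ncard := by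
    rw [Finset.sum_congr rfl fun (v : A) _ =>
      (Set.ncard_inter_add_ncard_sdiff_eq_ncard _ _ (hfn _)).trans (hΓ.2.2 v)]
    simp [mul_comm, ← Nat.card_eq_fintype_card, Nat.card_coe_set_eq]
  rw [Finset.sum_add_distrib] at h4
  omega

lemma finite_outerBoundary (hΓ : IsCayleyTree2 Γ) {A : Set V} (hfin : A.Finite) :
    (outerBoundary Γ A).Finite := by
  refine (hfin.biUnion fun v _ =>
    Set.finite_of_ncard_ne_zero (s := Γ.neighborSet v) (by rw [hΓ.2.2 v]; decide)).subset ?_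
  rintro x ⟨-, y, hy, h⟩
  exact Set.mem_biUnion hy h.symm

lemma ballSet_succ (hc : Γ.Connected) (x₀ : V) (n : ℕ) :
    ballSet Γ x₀ (n + 1) = ballSet Γ x₀ n ∪ outerBoundary Γ (ballSet Γ x₀ n) := by
  ext x
  simp only [ballSet, outerBoundary, Set.mem_union, Set.mem_ofPred_eq]
  constructor
  · intro h
    by_cases hx : Γ.dist x₀ x ≤ n
    · exact .inl hx
    · obtain ⟨p, hp⟩ := hc.exists_walk_length_eq_dist x x₀
      rw [Γ.dist_comm] at hp
      cases p with
      | nil => simp at hx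
      | cons hadj q =>
        refine .inr ⟨hx, _, ?_, hadj⟩
        have := SimpleGraph.dist_le q
        rw [Γ.dist_comm]
        simp at hp
        omega
  · rintro (h | ⟨-, y, hy, h⟩)
    · omega
    · have := hc.dist_triangle (u := x₀) (v := y) (w := x)
      rw [SimpleGraph.dist_eq_one_iff_adj.2 h.symm] at this
      omega

lemma ballSet_zero (hc : Γ.Connected) (x₀ : V) : ballSet Γ x₀ 0 = {x₀} := by
  ext x
  simp [ballSet, hc.dist_eq_zero_iff, eq_comm]

lemma finite_ballSet (hΓ : IsCayleyTree2 Γ) (x₀ : V) (n : ℕ) : (ballSet Γ x₀ n).Finite := by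
  induction n with
  | zero => simp [ballSet_zero hΓ.1]
  | succ n ih => rw [ballSet_succ hΓ.1]; exact ih.union (finite_outerBoundary hΓ ih)

lemma connected_induce_ballSet (hc : Γ.Connected) (x₀ : V) (n : ℕ) :
    (Γ.induce (ballSet Γ x₀ n)).Connected := by
  classical
  refine Γ.induce_connected_of_patches x₀ (by simp [ballSet]) fun {v} hv => ?_
  obtain ⟨p, hp⟩ := hc.exists_walk_length_eq_dist x₀ v
  refine ⟨{u | u ∈ p.support}, fun u hu => ?_, p.start_mem_support, p.end_mem_support,
    p.connected_induce_support.preconnected _ _⟩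
  have h1 := SimpleGraph.dist_le (p.takeUntil u hu)
  have h2 := p.length_takeUntil_le_length hu
  simp only [ballSet, Set.mem_ofPred_eq] at hv ⊢
  omega

lemma ncard_innerEdges_add_ncard_cutEdges_ballSet (hΓ : IsCayleyTree2 Γ) (x₀ : V) (n : ℕ) :
    (innerEdges Γ (ballSet Γ x₀ n)).ncard + (cutEdges Γ (ballSet Γ x₀ n)).ncard + 1 =
      (ballSet Γ x₀ (n + 1)).ncard := by
  have hf := finite_ballSet hΓ x₀ n
  have hc := connected_induce_ballSet hΓ.1 x₀ n
  rw [ballSet_succ hΓ.1, Set.ncard_union_eq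
    (Set.disjoint_left.2 fun x hx hx' => hx'.1 hx) hf (finite_outerBoundary hΓ hf),
    ncard_cutEdges hΓ.2.1 hc]
  have := ncard_innerEdges_add_one hΓ.2.1 hf hc
  omega

lemma finite_innerEdges {A : Set V} (hfin : A.Finite) : (innerEdges Γ A).Finite := by
  have := hfin.to_subtype
  rw [← image_edgeSet_induce]
  exact Set.toFinite _

lemma finite_cutEdges (hΓ : IsCayleyTree2 Γ) {A : Set V} (hfin : A.Finite) :
    (cutEdges Γ A).Finite := by
  refine (finite_innerEdges (Γ := Γ) (hfin.union (finite_outerBoundary hΓ hfin))).subset ?_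
  intro e
  induction e with | _ x y =>
  rintro ⟨he, hin, hout⟩
  refine ⟨he, ?_⟩
  have he' : Γ.Adj x y := he
  have := he'.symm
  simp only [Sym2.mem_iff] at hin hout ⊢
  simp only [Set.mem_union, outerBoundary, Set.mem_ofPred_eq]
  grind

lemma finite_meetingEdges (hΓ : IsCayleyTree2 Γ) {A : Set V} (hfin : A.Finite) :
    (meetingEdges Γ A).Finite := by
  rw [meetingEdges_eq_union]
  exact (finite_innerEdges hfin).union (finite_cutEdges hΓ hfin)

lemma IsCompOf.subset_of_connected {S C D : Set V} (hC : IsCompOf Γ S C) (hD : D ⊆ S)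
    (hconn : (Γ.induce D).Connected) {x : V} (hxD : x ∈ D) (hxC : x ∈ C) : D ⊆ C := by
  intro y hy
  have key : ∀ a b : D, (Γ.induce D).Walk a b → (a : V) ∈ C → (b : V) ∈ C := by
    intro a b p
    induction p with
    | nil => exact id
    | cons h q ih => exact fun ha => ih (hC.2.2.2 _ (hD (Subtype.prop _)) _ ha h.symm)
  exact (hconn.preconnected ⟨x, hxD⟩ ⟨y, hy⟩).elim fun p => key _ _ p hxC

lemma IsCompOf.eq_of_mem {S C D : Set V} (hC : IsCompOf Γ S C) (hD : IsCompOf Γ S D) {x : V}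
    (hxC : x ∈ C) (hxD : x ∈ D) : C = D :=
  (hD.subset_of_connected hC.1 hC.2.2.1 hxC hxD).antisymm
    (hC.subset_of_connected hD.1 hD.2.2.1 hxD hxC)

lemma exists_isCompOf_mem {S : Set V} {x : V} (hx : x ∈ S) : ∃ C, IsCompOf Γ S C ∧ x ∈ C := by
  let F : Set (Set V) := {D | D ⊆ S ∧ x ∈ D ∧ (Γ.induce D).Connected}
  have hF : {x} ∈ F := ⟨by simpa using hx, rfl, by simp⟩
  refine ⟨⋃₀ F, ⟨Set.sUnion_subset fun D hD => hD.1, ⟨x, {x}, hF, rfl⟩,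
    Γ.induce_sUnion_connected_of_pairwise_not_disjoint ⟨_, hF⟩
      (fun hs ht => ⟨x, hs.2.1, ht.2.1⟩) fun hs => hs.2.2, ?_⟩, {x}, hF, rfl⟩
  rintro z hz y ⟨D, hD, hy⟩ hzy
  refine ⟨D ∪ {z}, ⟨Set.union_subset hD.1 (by simpa using hz), .inl hD.2.1, ?_⟩, .inr rfl⟩
  refine Γ.connected_induce_union hD.2.2.preconnected ?_ hy rfl hzy.symm
  rw [SimpleGraph.induce_singleton_eq_top]
  exact SimpleGraph.preconnected_top

lemma meetingEdges_eq_biUnion_isCompOf (S : Set V) :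
    meetingEdges Γ S = ⋃ C ∈ {C | IsCompOf Γ S C}, meetingEdges Γ C := by
  ext e
  simp only [Set.mem_iUnion, exists_prop, Set.mem_ofPred_eq]
  constructor
  · rintro ⟨he, x, hx, hxe⟩
    obtain ⟨C, hC, hxC⟩ := exists_isCompOf_mem (Γ := Γ) hx
    exact ⟨C, hC, he, x, hxC, hxe⟩
  · rintro ⟨C, hC, he, x, hx, hxe⟩
    exact ⟨he, x, hC.1 hx, hxe⟩

lemma pairwiseDisjoint_meetingEdges_isCompOf (S : Set V) :
    {C | IsCompOf Γ S C}.PairwiseDisjoint (meetingEdges Γ) := by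
  intro C hC D hD hne
  refine Set.disjoint_left.2 ?_
  rintro e ⟨he, x, hx, hxe⟩ ⟨-, y, hy, hye⟩
  by_cases hxy : x = y
  · exact hne (hC.eq_of_mem hD hx (hxy ▸ hy))
  · rw [(Sym2.mem_and_mem_iff hxy).1 ⟨hxe, hye⟩] at he
    exact hne (hC.eq_of_mem hD hx (hD.2.2.2 x (hC.1 hx) y hy he))

lemma finsum_mem_const_real {α : Type*} {s : Set α} (hs : s.Finite) (c : ℝ) :
    ∑ᶠ _a ∈ s, c = s.ncard * c := by
  rw [finsum_mem_eq_finite_toFinset_sum _ hs, Finset.sum_const, nsmul_eq_mul,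
    Set.ncard_eq_toFinset_card s hs]

end ContourCounting

/-- Contour representation of the energy of the two-spin model with boundary condition
`v₁`: for `ω ∈ Ω_n^{(1)}`,
`H_n^{(1)}(ω) = (λ₂₁ + λ₂₂ − 2λ₁₁)·B(ω) + 3m(ω)·(λ₁₁ − λ₂₂) + λ₁₁·(|V_{n+1}| − 1)`,
where `m(ω)` is the number of connected components of `ω⁻¹(v₂)` and `B(ω) = ∑_C |∂C|` is
the total contour length. -/
theorem genH_contour_form {V W : Type*} (Γ : SimpleGraph V) (hΓ : IsCayleyTree2 Γ)
    (x₀ : V) (v₁ v₂ : W) (hv : v₁ ≠ v₂) (lam : W → W → ℝ)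
    (hsymm : ∀ a b, lam a b = lam b a) (n : ℕ) (hn : 1 ≤ n)
    (ω : V → W) (hω : ω ∈ OmegaGen Γ x₀ n v₁ v₂) :
    genH Γ x₀ n lam hsymm ω =
      (lam v₂ v₁ + lam v₂ v₂ - 2 * lam v₁ v₁) *
          ∑ᶠ C ∈ {C : Set V | IsCompOf Γ {x | ω x = v₂} C},
            ((outerBoundary Γ C).ncard : ℝ) +
        3 * ({C : Set V | IsCompOf Γ {x | ω x = v₂} C}.ncard : ℝ) *
          (lam v₁ v₁ - lam v₂ v₂) +
        lam v₁ v₁ * (((ballSet Γ x₀ (n + 1)).ncard : ℝ) - 1) := by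
  set S : Set V := {x | ω x = v₂}
  set f : Sym2 V → ℝ :=
    Sym2.lift ⟨fun x y => lam (ω x) (ω y), fun x y => hsymm (ω x) (ω y)⟩
  have hfxy : ∀ x y, f s(x, y) = lam (ω x) (ω y) := fun _ _ => rfl
  have hB := finite_ballSet hΓ x₀ n
  have hM := finite_meetingEdges hΓ hB
  have hSB : S ⊆ ballSet Γ x₀ n := by
    intro x hx
    by_contra hxB
    exact hv ((hω.2 x hxB).symm.trans hx)
  have hSf := hB.subset hSB
  have hnotS : ∀ x, x ∉ S → ω x = v₁ := fun x hx => (hω.1 x).resolve_right hx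
  have hcomps : {C : Set V | IsCompOf Γ S C}.Finite :=
    hSf.finite_subsets.subset fun C hC => hC.1
  have hsplit : genH Γ x₀ n lam hsymm ω =
      ∑ᶠ e ∈ meetingEdges Γ (ballSet Γ x₀ n), (f e - lam v₁ v₁) +
        (meetingEdges Γ (ballSet Γ x₀ n)).ncard * lam v₁ v₁ := by
    rw [← finsum_mem_const_real hM, ← finsum_mem_add_distrib hM]
    simp [genH, f]
  have hrestrict : ∑ᶠ e ∈ meetingEdges Γ (ballSet Γ x₀ n), (f e - lam v₁ v₁) =
      ∑ᶠ e ∈ meetingEdges Γ S, (f e - lam v₁ v₁) := by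
    refine finsum_mem_inter_support_eq _ _ _ ?_
    ext e
    refine and_congr_left fun he =>
      ⟨fun h => ⟨h.1, ?_⟩, fun ⟨h, x, hx, hxe⟩ => ⟨h, x, hSB hx, hxe⟩⟩
    by_contra! hno
    apply he
    induction e with | _ x y =>
    beta_reduce
    rw [hfxy, hnotS x fun hx => hno x hx (by simp), hnotS y fun hy => hno y hy (by simp), sub_self]
  have hcomp : ∀ C, IsCompOf Γ S C → ∑ᶠ e ∈ meetingEdges Γ C, (f e - lam v₁ v₁) =
      (lam v₂ v₁ + lam v₂ v₂ - 2 * lam v₁ v₁) * (outerBoundary Γ C).ncard +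
        3 * (lam v₁ v₁ - lam v₂ v₂) := by
    intro C hC
    have hCf := hSf.subset hC.1
    have hin : ∑ᶠ e ∈ innerEdges Γ C, (f e - lam v₁ v₁) =
        (innerEdges Γ C).ncard * (lam v₂ v₂ - lam v₁ v₁) := by
      rw [← finsum_mem_const_real (finite_innerEdges hCf)]
      refine finsum_mem_congr rfl fun e he => ?_
      induction e with | _ x y =>
      have hx : ω x = v₂ := hC.1 (he.2 x (by simp))
      have hy : ω y = v₂ := hC.1 (he.2 y (by simp))
      rw [hfxy, hx, hy]
    have hcut : ∑ᶠ e ∈ cutEdges Γ C, (f e - lam v₁ v₁) =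
        (cutEdges Γ C).ncard * (lam v₂ v₁ - lam v₁ v₁) := by
      rw [← finsum_mem_const_real (finite_cutEdges hΓ hCf)]
      refine finsum_mem_congr rfl ?_
      rintro e ⟨he, ⟨x, hxe, hx⟩, y, hye, hy⟩
      have hxy : x ≠ y := fun h => hy (h ▸ hx)
      rw [(Sym2.mem_and_mem_iff hxy).1 ⟨hxe, hye⟩] at he ⊢
      have hx₂ : ω x = v₂ := hC.1 hx
      rw [hfxy, hx₂, hnotS y fun hyS => hy (hC.2.2.2 y hyS x hx (SimpleGraph.Adj.symm he))]
    rw [meetingEdges_eq_union, finsum_mem_union (disjoint_innerEdges_cutEdges C)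
      (finite_innerEdges hCf) (finite_cutEdges hΓ hCf), hin, hcut, ncard_cutEdges hΓ.2.1 hC.2.2.1]
    have h : (innerEdges Γ C).ncard + 3 = (outerBoundary Γ C).ncard := by
      rw [ncard_outerBoundary hΓ hCf hC.2.2.1,
        ← ncard_innerEdges_add_one hΓ.2.1 hCf hC.2.2.1]
    rw [← h]
    push_cast
    ring
  have hcard : ((meetingEdges Γ (ballSet Γ x₀ n)).ncard : ℝ) =
      (ballSet Γ x₀ (n + 1)).ncard - 1 := by
    rw [← ncard_innerEdges_add_ncard_cutEdges_ballSet hΓ, meetingEdges_eq_union,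
      Set.ncard_union_eq (disjoint_innerEdges_cutEdges _) (finite_innerEdges hB)
        (finite_cutEdges hΓ hB)]
    push_cast
    ring
  have hmul := smul_finsum_mem (r := lam v₂ v₁ + lam v₂ v₂ - 2 * lam v₁ v₁)
    (f := fun C => ((outerBoundary Γ C).ncard : ℝ)) hcomps
  simp only [smul_eq_mul] at hmul
  rw [hsplit, hrestrict, meetingEdges_eq_biUnion_isCompOf,
    finsum_mem_biUnion (pairwiseDisjoint_meetingEdges_isCompOf S) hcomps
      fun C hC => finite_meetingEdges hΓ (hSf.subset hC.1),
    finsum_mem_congr (t := {C | IsCompOf Γ S C}) rfl hcomp, finsum_mem_add_distrib hcomps, finsum_mem_const_real hcomps,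
    ← hmul, hcard]
  ring
end
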